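/- Dual L⁴ Bourgain estimate: There exists a constant C > 0 such that for every u ∈ L^{4/3}(ℝ×𝕋) one has ‖u‖_{X^{0,-3/8}} ≤ C ‖u‖_{L^{4/3}(ℝ×𝕋)}. -/

import Mathlib

open MeasureTheory Complex Filter
open scoped ENNReal NNReal

noncomputable section

abbrev Torus := AddCircle (2 * Real.pi)

instance : Fact (0 < 2 * Real.pi) := ⟨by positivity⟩

/-- Japanese bracket `⟨x⟩ = (1+x²)^{1/2}`. -/
def jb (x : ℝ) : ℝ := Real.sqrt (1 + x ^ 2)

/-- Space-time Fourier transform `ũ(σ,k) = ∫_ℝ ∫_𝕋 u(t,x) e^{-iσt} e^{-ikx} dx dt`. -/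
def stFT (u : ℝ → Torus → ℂ) (σ : ℝ) (k : ℤ) : ℂ :=
  ∫ t : ℝ, Complex.exp (-Complex.I * σ * t) * ((2 * Real.pi) * fourierCoeff (u t) k)

/-- Square of the Bourgain `X^{s,b}` norm (valued in `ℝ≥0∞`). -/
def XnormSq (s b : ℝ) (u : ℝ → Torus → ℂ) : ℝ≥0∞ :=
  ∫⁻ σ : ℝ, ∑' k : ℤ,
    ENNReal.ofReal (jb (k : ℝ) ^ (2*s) * jb (σ + (k : ℝ)^2) ^ (2*b) * ‖stFT u σ k‖ ^ 2)

/-- The Bourgain `X^{s,b}` norm. -/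
def Xnorm (s b : ℝ) (u : ℝ → Torus → ℂ) : ℝ≥0∞ := XnormSq s b u ^ (1/2 : ℝ)

/-- Membership in the Bourgain space `X^{s,b}`. -/
def MemX (s b : ℝ) (u : ℝ → Torus → ℂ) : Prop := XnormSq s b u ≠ ⊤

/-- `L^p` norm on space-time `ℝ × 𝕋`. -/
def LpST (p : ℝ) (u : ℝ → Torus → ℂ) : ℝ≥0∞ :=
  (∫⁻ t : ℝ, ∫⁻ x : Torus, (‖u t x‖₊ : ℝ≥0∞) ^ p) ^ (1/p)

/-- `L²(𝕋)` norm. -/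
def L2T (f : Torus → ℂ) : ℝ≥0∞ := (∫⁻ x : Torus, (‖f x‖₊ : ℝ≥0∞) ^ (2:ℝ)) ^ (1/2 : ℝ)

/-- Square of the `H^s(𝕋)` norm. -/
def HsNormSq (s : ℝ) (f : Torus → ℂ) : ℝ≥0∞ :=
  ∑' k : ℤ, ENNReal.ofReal (jb (k : ℝ) ^ (2*s) * ‖fourierCoeff f k‖ ^ 2)

/-- The `H^s(𝕋)` norm. -/
def HsNorm (s : ℝ) (f : Torus → ℂ) : ℝ≥0∞ := HsNormSq s f ^ (1/2 : ℝ)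

/-- The free Schrödinger group `e^{it∂ₓ²}` on the torus, acting on Fourier
coefficients by multiplication with `e^{-itk²}`. -/
def schrodGroup (t : ℝ) (f : Torus → ℂ) : Torus → ℂ :=
  fun x => ∑' k : ℤ, Complex.exp (-Complex.I * t * (k : ℂ)^2) * fourierCoeff f k * fourier k x

/-- Frequency projection `Π_K` onto frequencies `|k| ≤ K`. -/
def projK (K : ℝ) (f : Torus → ℂ) : Torus → ℂ :=
  fun x => ∑' k : ℤ, (if |(k : ℝ)| ≤ K then fourierCoeff f k else 0) * fourier k x

/-- `u` solves the cubic NLS `i∂ₜu = -∂ₓ²u + |u|²u` (formulated on Fourier coefficients). -/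
def IsNLSSolution (u : ℝ → Torus → ℂ) : Prop :=
  ∀ t : ℝ, ∀ k : ℤ,
    HasDerivAt (fun t' => fourierCoeff (u t') k)
      (-Complex.I * (k : ℂ)^2 * fourierCoeff (u t) k
        - Complex.I * fourierCoeff (fun x => (‖u t x‖ : ℂ)^2 * u t x) k) t

/-- `u : [0,T] → H^s` is continuous with values in `H^s`. -/
def ContHs (s T : ℝ) (u : ℝ → Torus → ℂ) : Prop :=
  (∀ t ∈ Set.Icc (0:ℝ) T, HsNormSq s (u t) ≠ ⊤) ∧
  ∀ t₀ ∈ Set.Icc (0:ℝ) T,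
    Filter.Tendsto (fun t => HsNorm s (fun x => u t x - u t₀ x))
      (nhdsWithin t₀ (Set.Icc (0:ℝ) T)) (nhds 0)

/- discrete part -/

/-- `d_τ(σ) = (e^{iτσ} - 1)/τ`. -/
def dtau (τ σ : ℝ) : ℂ := (Complex.exp (Complex.I * τ * σ) - 1) / τ

/-- Discrete space-time Fourier transform of a sequence of functions on the torus. -/
def dFT (τ : ℝ) (u : ℤ → Torus → ℂ) (σ : ℝ) (k : ℤ) : ℂ :=
  τ * ∑' m : ℤ, fourierCoeff (u m) k * Complex.exp (Complex.I * m * τ * σ)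

/-- Square of the discrete Bourgain `X^{s,b}_τ` norm. -/
def XdNormSq (τ s b : ℝ) (u : ℤ → Torus → ℂ) : ℝ≥0∞ :=
  ENNReal.ofReal (1/(2*Real.pi)) *
    ∫⁻ σ in Set.Ioc (-(Real.pi/τ)) (Real.pi/τ), ∑' k : ℤ,
      ENNReal.ofReal (jb (k : ℝ) ^ (2*s) * jb ‖dtau τ (σ - (k : ℝ)^2)‖ ^ (2*b)
        * ‖dFT τ u σ k‖ ^ 2)

/-- The discrete Bourgain `X^{s,b}_τ` norm. -/
def XdNorm (τ s b : ℝ) (u : ℤ → Torus → ℂ) : ℝ≥0∞ := XdNormSq τ s b u ^ (1/2 : ℝ)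

/-- `ℓ^p_τ L^p(𝕋)` norm of a sequence of functions. -/
def lpLp (τ p : ℝ) (u : ℤ → Torus → ℂ) : ℝ≥0∞ :=
  (ENNReal.ofReal τ * ∑' n : ℤ, ∫⁻ x : Torus, (‖u n x‖₊ : ℝ≥0∞) ^ p) ^ (1/p)


open scoped FourierTransform ContDiff SchwartzMap in
lemma plancherel_aux (h : ℝ → ℂ) (h1 : Integrable h) (h2 : MemLp h 2) :
    ∫⁻ t, ‖𝓕 h t‖ₑ ^ (2:ℝ) = ∫⁻ t, ‖h t‖ₑ ^ (2:ℝ) := by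
  set H : Lp ℂ 2 (volume : Measure ℝ) := h2.toLp h with hH
  have hHh : H =ᵐ[volume] h := h2.coeFn_toLp
  have hc : Continuous (𝓕 h) :=
    VectorFourier.fourierIntegral_continuous Real.continuous_fourierChar
      (L := innerₗ ℝ) continuous_inner h1
  have key : ∀ᵐ x, (𝓕 H : Lp ℂ 2 (volume : Measure ℝ)) x = 𝓕 h x := by
    apply ae_eq_of_integral_contDiff_smul_eq
    · exact (Lp.memLp (𝓕 H)).locallyIntegrable (by norm_num)
    · exact hc.locallyIntegrable
    · intro g g_smooth g_cpt
      have hg₁ : HasCompactSupport (Complex.ofRealCLM ∘ g) := g_cpt.comp_left rfl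
      have hg₂ : ContDiff ℝ ∞ (Complex.ofRealCLM ∘ g) := by fun_prop
      set G : 𝓢(ℝ, ℂ) := hg₁.toSchwartzMap hg₂ with hG
      have e1 : ∫ x, g x • (𝓕 H : Lp ℂ 2 (volume : Measure ℝ)) x
          = Lp.toTemperedDistribution (𝓕 H : Lp ℂ 2 (volume : Measure ℝ)) G := by
        simp [hG]
      rw [e1, ← Lp.fourier_toTemperedDistribution_eq, TemperedDistribution.fourier_apply,
        Lp.toTemperedDistribution_apply]
      have e2 : ∫ x, (𝓕 G) x • H x = ∫ x, (𝓕 (G : ℝ → ℂ)) x • h x := by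
        apply integral_congr_ae
        filter_upwards [hHh] with x hx
        rw [hx, SchwartzMap.fourier_coe]
      rw [e2]
      have e3 := VectorFourier.integral_fourierIntegral_smul_eq_flip (L := innerₗ ℝ)
        Real.continuous_fourierChar continuous_inner (G.integrable (μ := volume)) h1
      rw [flip_innerₗ] at e3
      refine e3.trans ?_
      simp [hG]
      rfl
  have hn : ‖(𝓕 H : Lp ℂ 2 (volume : Measure ℝ))‖ = ‖H‖ := Lp.norm_fourier_eq H
  have hn2 : eLpNorm (𝓕 h) 2 volume = eLpNorm h 2 volume := by
    rw [← eLpNorm_congr_ae key, ← eLpNorm_congr_ae hHh]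
    rw [Lp.norm_def, Lp.norm_def, ENNReal.toReal_eq_toReal_iff' (Lp.eLpNorm_ne_top _) (Lp.eLpNorm_ne_top _)] at hn
    exact hn
  rw [eLpNorm_eq_lintegral_rpow_enorm_toReal (by norm_num) (by norm_num),
   eLpNorm_eq_lintegral_rpow_enorm_toReal (by norm_num) (by norm_num)] at hn2
  simp only [ENNReal.toReal_ofNat] at hn2
  exact (ENNReal.rpow_left_injective (by norm_num)) hn2

/-- inverse Fourier type integral -/
def EE (b : ℝ → ℂ) (t : ℝ) : ℂ := ∫ σ : ℝ, Complex.exp (Complex.I * σ * t) * b σ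

open scoped FourierTransform in
lemma EE_eq (b : ℝ → ℂ) (t : ℝ) : EE b t = 𝓕 b (-(t / (2 * Real.pi))) := by
  rw [Real.fourier_real_eq_integral_exp_smul]
  unfold EE
  congr 1
  ext σ
  rw [smul_eq_mul]
  congr 2
  push_cast
  field_simp

open scoped FourierTransform in
lemma EE_continuous (b : ℝ → ℂ) (h1 : Integrable b) : Continuous (EE b) := by
  have hc : Continuous (𝓕 b) :=
    VectorFourier.fourierIntegral_continuous Real.continuous_fourierChar
      (L := innerₗ ℝ) continuous_inner h1
  have : EE b = fun t => 𝓕 b (-(t / (2 * Real.pi))) := by ext t; exact EE_eq b t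
  rw [this]
  fun_prop

open scoped FourierTransform in
lemma EE_plancherel (h : ℝ → ℂ) (h1 : Integrable h) (h2 : MemLp h 2) :
    ∫⁻ t, ‖EE h t‖ₑ ^ (2:ℝ) = ENNReal.ofReal (2 * Real.pi) * ∫⁻ t, ‖h t‖ₑ ^ (2:ℝ) := by
  rw [← plancherel_aux h h1 h2]
  simp_rw [EE_eq]
  have hc : Continuous (𝓕 h) :=
    VectorFourier.fourierIntegral_continuous Real.continuous_fourierChar
      (L := innerₗ ℝ) continuous_inner h1
  have hm : Measurable (fun t => ‖𝓕 h t‖ₑ ^ (2:ℝ)) := by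
    have := hc.measurable
    fun_prop
  have hpi : (0:ℝ) < 2 * Real.pi := by positivity
  have e1 : ∀ t : ℝ, -(t / (2 * Real.pi)) = (-(1 / (2 * Real.pi))) * t := fun t => by ring
  have e2 : ∫⁻ t, ‖𝓕 h (-(t / (2 * Real.pi)))‖ₑ ^ (2:ℝ)
      = ∫⁻ t, ‖𝓕 h ((-(1 / (2 * Real.pi))) * t)‖ₑ ^ (2:ℝ) := by
    congr 1; ext t; rw [e1 t]
  rw [e2]
  rw [← lintegral_map (f := fun t => ‖𝓕 h t‖ₑ ^ (2:ℝ)) (g := fun t => (-(1 / (2 * Real.pi))) * t)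
    hm (by fun_prop), Real.map_volume_mul_left (by simp), lintegral_smul_measure, smul_eq_mul]
  congr 2
  rw [inv_neg, abs_neg, one_div, inv_inv, abs_of_pos hpi]

open scoped Convolution in
lemma EE_conv (b c : ℝ → ℂ) (hb : Integrable b) (hc : Integrable c) (t : ℝ) :
    EE (b ⋆[ContinuousLinearMap.mul ℂ ℂ] c) t = EE b t * EE c t := by
  simp only [EE_eq]
  exact Real.fourier_mul_convolution_eq hb hc _

lemma count_nonneg (T : Finset ℤ) (A D : ℝ) (s : ℕ) (hs : 4 * D ≤ (s:ℝ) ^ 2)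
    (hT : ∀ d ∈ T, 0 ≤ d ∧ |(d:ℝ) ^ 2 - A| ≤ 2 * D) : T.card ≤ s + 1 := by
  rcases T.eq_empty_or_nonempty with h | h
  · simp [h]
  · have hmin := T.min'_mem h
    set d0 := T.min' h
    have hsub : T ⊆ Finset.Icc d0 (d0 + s) := by
      intro d hd
      have hle : d0 ≤ d := T.min'_le d hd
      rw [Finset.mem_Icc]
      refine ⟨hle, ?_⟩
      have h1 := abs_le.1 (hT d hd).2
      have h2 := abs_le.1 (hT d0 hmin).2
      have h0 : (0:ℝ) ≤ d0 := by exact_mod_cast (hT d0 hmin).1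
      have hle' : (d0:ℝ) ≤ d := by exact_mod_cast hle
      have h3 : ((d:ℝ) - d0) ^ 2 ≤ (s:ℝ) ^ 2 := by nlinarith
      have h4 : (d:ℝ) - d0 ≤ s := abs_le_of_sq_le_sq' h3 (by positivity) |>.2
      have h5 : (d:ℝ) ≤ d0 + s := by linarith
      exact_mod_cast h5
    have := Finset.card_le_card hsub
    simp at this
    omega

lemma count_all (T : Finset ℤ) (A D : ℝ) (s : ℕ) (hs : 4 * D ≤ (s:ℝ) ^ 2)
    (hT : ∀ d ∈ T, |(d:ℝ) ^ 2 - A| ≤ 2 * D) : T.card ≤ 2 * (s + 1) := by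
  classical
  have h1 := count_nonneg (T.filter (0 ≤ ·)) A D s hs (by
    intro d hd
    rw [Finset.mem_filter] at hd
    exact ⟨hd.2, hT d hd.1⟩)
  have h2 := count_nonneg ((T.filter (¬ 0 ≤ ·)).image (fun d => -d)) A D s hs (by
    intro d hd
    rw [Finset.mem_image] at hd
    obtain ⟨e, he, rfl⟩ := hd
    rw [Finset.mem_filter] at he
    refine ⟨by omega, ?_⟩
    have := hT e he.1
    push_cast
    rwa [neg_sq])
  rw [Finset.card_image_of_injective _ neg_injective] at h2
  have h3 := Finset.card_filter_add_card_filter_not (s := T) (fun d : ℤ => 0 ≤ d)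
  omega

lemma count_pairs (P : Finset (ℤ × ℤ)) (j : ℤ) (σ : ℝ) (n : ℕ)
    (hP : ∀ p ∈ P, p.1 + p.2 = j ∧ |σ + (p.1:ℝ) ^ 2 + (p.2:ℝ) ^ 2| ≤ 2 * 256 ^ (n + 1)) :
    P.card ≤ 94 * 16 ^ n := by
  classical
  have hinj : Set.InjOn (fun p : ℤ × ℤ => p.1 - p.2) P := by
    intro p hp q hq h
    have h1 := (hP p hp).1
    have h2 := (hP q hq).1
    simp only at h
    ext <;> omega
  rw [← Finset.card_image_of_injOn hinj]
  have hpw : (256:ℝ) ^ n = (16 ^ n) ^ 2 := by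
    rw [← pow_mul, mul_comm, pow_mul]; norm_num
  have := count_all (P.image (fun p : ℤ × ℤ => p.1 - p.2)) (-2 * σ - (j:ℝ) ^ 2)
    (2 * 256 ^ (n + 1)) (46 * 16 ^ n) (by
      push_cast
      rw [pow_succ, hpw]
      have : (0:ℝ) ≤ (16 ^ n) ^ 2 := by positivity
      nlinarith) (by
      intro d hd
      rw [Finset.mem_image] at hd
      obtain ⟨p, hp, rfl⟩ := hd
      have h1 := hP p hp
      have h2 : (j:ℝ) = p.1 + p.2 := by exact_mod_cast h1.1.symm
      have h3 : ((p.1 - p.2 : ℤ) : ℝ) ^ 2 - (-2 * σ - (j:ℝ) ^ 2)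
          = 2 * (σ + (p.1:ℝ) ^ 2 + (p.2:ℝ) ^ 2) := by
        rw [h2]; push_cast; ring
      rw [h3, abs_mul, abs_two]
      linarith [h1.2])
  have h16 : 1 ≤ 16 ^ n := Nat.one_le_pow _ _ (by norm_num)
  omega

open scoped Convolution in
lemma conv_sq (b c : ℝ → ℂ) (hb : Measurable b) (hc : Measurable c) (A : Set ℝ)
    (hA : MeasurableSet A) (hbA : ∀ s, s ∉ A → b s = 0) (σ : ℝ) :
    ‖(b ⋆[ContinuousLinearMap.mul ℂ ℂ] c) σ‖ₑ ^ 2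
      ≤ volume A * ∫⁻ s, ‖b s‖ₑ ^ 2 * ‖c (σ - s)‖ₑ ^ 2 := by
  have h1 : ‖(b ⋆[ContinuousLinearMap.mul ℂ ℂ] c) σ‖ₑ ≤ ∫⁻ s, ‖b s‖ₑ * ‖c (σ - s)‖ₑ := by
    rw [convolution_def]
    refine (enorm_integral_le_lintegral_enorm _).trans (le_of_eq ?_)
    congr 1; ext s
    simp [enorm_mul]
  have h2 : ∫⁻ s, ‖b s‖ₑ * ‖c (σ - s)‖ₑ
      = ∫⁻ s, ((A.indicator (1 : ℝ → ℝ≥0∞)) * (fun s => ‖b s‖ₑ * ‖c (σ - s)‖ₑ)) s := by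
    congr 1; ext s
    by_cases hs : s ∈ A
    · simp [hs]
    · simp [hs, hbA s hs]
  have hm : Measurable (fun s => ‖b s‖ₑ * ‖c (σ - s)‖ₑ) := by fun_prop
  have h3 := ENNReal.lintegral_mul_le_Lp_mul_Lq volume Real.HolderConjugate.two_two
    (f := A.indicator 1) (g := fun s => ‖b s‖ₑ * ‖c (σ - s)‖ₑ)
    ((measurable_one.indicator hA).aemeasurable) hm.aemeasurable
  have h4 : ∫⁻ s, (A.indicator (1 : ℝ → ℝ≥0∞) s) ^ (2:ℝ) = volume A := by
    rw [← lintegral_indicator_one hA]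
    congr 1; ext s
    by_cases hs : s ∈ A <;> simp [hs]
  rw [h4] at h3
  calc _ ≤ (volume A ^ (1 / (2:ℝ)) * (∫⁻ s, (‖b s‖ₑ * ‖c (σ - s)‖ₑ) ^ (2:ℝ)) ^ (1 / (2:ℝ))) ^ 2 := by
        gcongr
        exact h1.trans (h2.le.trans h3)
    _ = _ := by
        rw [mul_pow, ← ENNReal.rpow_natCast, ← ENNReal.rpow_natCast, ← ENNReal.rpow_mul,
          ← ENNReal.rpow_mul]
        norm_num
        congr 2
        ext s
        rw [mul_pow]

lemma conv_L2 (b c : ℝ → ℂ) (hb : Measurable b) (hc : Measurable c) :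
    ∫⁻ σ, ∫⁻ s, ‖b s‖ₑ ^ 2 * ‖c (σ - s)‖ₑ ^ 2
      = (∫⁻ s, ‖b s‖ₑ ^ 2) * ∫⁻ s, ‖c s‖ₑ ^ 2 := by
  rw [lintegral_lintegral_swap (by fun_prop)]
  have : ∀ s, ∫⁻ σ, ‖b s‖ₑ ^ 2 * ‖c (σ - s)‖ₑ ^ 2 = ‖b s‖ₑ ^ 2 * ∫⁻ σ, ‖c σ‖ₑ ^ 2 := by
    intro s
    rw [lintegral_const_mul _ (by fun_prop)]
    congr 1
    exact lintegral_sub_right_eq_self (fun σ => ‖c σ‖ₑ ^ 2) s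
  simp_rw [this]
  rw [lintegral_mul_const _ (by fun_prop)]

lemma parseval_torus (J : Finset ℤ) (a : ℤ → ℂ) :
    ∫⁻ x : Torus, ‖∑ j ∈ J, a j * fourier j x‖ₑ ^ 2
      = ENNReal.ofReal (2 * Real.pi) * ∑ j ∈ J, ‖a j‖ₑ ^ 2 := by
  rw [AddCircle.volume_eq_smul_haarAddCircle, lintegral_smul_measure, smul_eq_mul]
  congr 1
  set F : C(Torus, ℂ) := ∑ j ∈ J, a j • fourier j with hF
  have hFx : ∀ x, F x = ∑ j ∈ J, a j * fourier j x := by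
    intro x; simp [hF, ContinuousMap.sum_apply]
  set G : Lp ℂ 2 (@AddCircle.haarAddCircle (2 * Real.pi) _) :=
    ContinuousMap.toLp 2 AddCircle.haarAddCircle ℂ F with hG
  have hGs : G = ∑ j ∈ J, a j • fourierLp 2 j := by
    rw [hG, hF, map_sum]
    simp_rw [map_smul]
  have hn : ‖G‖ ^ 2 = ∑ j ∈ J, ‖a j‖ ^ 2 := by
    have h1 : (inner ℂ G G : ℂ) = ∑ j ∈ J, (starRingEnd ℂ) (a j) * a j := by
      rw [hGs]; exact orthonormal_fourier.inner_sum a a J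
    rw [inner_self_eq_norm_sq_to_K] at h1
    have h2 : (((‖G‖ ^ 2 : ℝ)) : ℂ) = ((∑ j ∈ J, ‖a j‖ ^ 2 : ℝ) : ℂ) := by
      push_cast
      refine Eq.trans h1 ?_
      refine Finset.sum_congr rfl fun j _ => ?_
      rw [mul_comm, Complex.mul_conj, Complex.normSq_eq_norm_sq]
      push_cast; rfl
    exact_mod_cast h2
  have hae : ∀ᵐ x ∂(@AddCircle.haarAddCircle (2 * Real.pi) _), G x = F x :=
    ContinuousMap.coeFn_toLp _ F
  have e1 : ∫⁻ x, ‖∑ j ∈ J, a j * fourier j x‖ₑ ^ 2 ∂(@AddCircle.haarAddCircle (2 * Real.pi) _)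
     = eLpNorm G 2 AddCircle.haarAddCircle ^ 2 := by
    rw [eLpNorm_congr_ae hae, eLpNorm_eq_lintegral_rpow_enorm_toReal (by norm_num) (by norm_num),
      ← ENNReal.rpow_natCast, ← ENNReal.rpow_mul]
    simp_rw [hFx]
    norm_num [-fourier_apply]
  rw [e1]
  have e2 : eLpNorm G 2 AddCircle.haarAddCircle = ENNReal.ofReal ‖G‖ := by
    rw [Lp.norm_def, ENNReal.ofReal_toReal (Lp.eLpNorm_ne_top _)]
  rw [e2, ← ENNReal.ofReal_pow (norm_nonneg _), hn, ENNReal.ofReal_sum_of_nonneg (by intros; positivity)]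
  refine Finset.sum_congr rfl fun j _ => ?_
  rw [ENNReal.ofReal_pow (norm_nonneg _), ofReal_norm]

/-- trigonometric superposition -/
def VV (K : Finset ℤ) (b : ℤ → ℝ → ℂ) (t : ℝ) (x : Torus) : ℂ :=
  ∑ k ∈ K, EE (b k) t * fourier k x

/-- convenient class of functions -/
structure Nice (f : ℝ → ℂ) : Prop where
  meas : Measurable f
  int : Integrable f
  l2 : MemLp f 2

lemma Nice.fin {f : ℝ → ℂ} (h : Nice f) : ∫⁻ s, ‖f s‖ₑ ^ 2 < ∞ := by
  have := h.l2.2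
  rw [eLpNorm_lt_top_iff_lintegral_rpow_enorm_lt_top (by norm_num) (by norm_num)] at this
  simpa using this

lemma enorm_sum_sq_le {ι : Type*} (P : Finset ι) (y : ι → ℂ) (N : ℕ)
    (hN : (P.filter (fun p => y p ≠ 0)).card ≤ N) :
    ‖∑ p ∈ P, y p‖ₑ ^ 2 ≤ (N : ℝ≥0∞) * ∑ p ∈ P, ‖y p‖ₑ ^ 2 := by
  classical
  rw [← Finset.sum_filter_ne_zero]
  set Q := P.filter (fun p => y p ≠ 0)
  have h1 : ‖∑ p ∈ Q, y p‖ ^ 2 ≤ N * ∑ p ∈ Q, ‖y p‖ ^ 2 := by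
    calc ‖∑ p ∈ Q, y p‖ ^ 2 ≤ (∑ p ∈ Q, ‖y p‖) ^ 2 := by
          gcongr; exact norm_sum_le _ _
      _ ≤ Q.card * ∑ p ∈ Q, ‖y p‖ ^ 2 := sq_sum_le_card_mul_sum_sq
      _ ≤ _ := by gcongr
  have h2 := ENNReal.ofReal_le_ofReal h1
  rw [ENNReal.ofReal_pow (norm_nonneg _), ofReal_norm, ENNReal.ofReal_mul (by positivity),
    ENNReal.ofReal_natCast, ENNReal.ofReal_sum_of_nonneg (by intros; positivity)] at h2
  refine h2.trans ?_
  gcongr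
  calc _ = ∑ p ∈ Q, ‖y p‖ₑ ^ 2 := by
        refine Finset.sum_congr rfl fun j _ => ?_
        rw [ENNReal.ofReal_pow (norm_nonneg _), ofReal_norm]
    _ ≤ _ := Finset.sum_le_sum_of_subset (Finset.filter_subset _ _)

lemma EE_sum {ι : Type*} (P : Finset ι) (f : ι → ℝ → ℂ) (hf : ∀ p ∈ P, Integrable (f p)) (t : ℝ) :
    EE (fun σ => ∑ p ∈ P, f p σ) t = ∑ p ∈ P, EE (f p) t := by
  unfold EE
  simp_rw [Finset.mul_sum]
  rw [integral_finsetSum]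
  intro p hp
  refine (hf p hp).bdd_mul (c := 1) (by fun_prop) (Eventually.of_forall fun σ => ?_)
  rw [Complex.norm_exp]
  simp

open scoped Convolution in
lemma bilin (K : Finset ℤ) (b c : ℤ → ℝ → ℂ) (hb : ∀ k, Nice (b k)) (hc : ∀ k, Nice (c k))
    (m n : ℕ) (hmn : m ≤ n)
    (hbs : ∀ k σ, b k σ ≠ 0 → |σ + (k:ℝ) ^ 2| ≤ 256 ^ (m + 1))
    (hcs : ∀ k σ, c k σ ≠ 0 → |σ + (k:ℝ) ^ 2| ≤ 256 ^ (n + 1)) :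
    ∫⁻ t, ∫⁻ x : Torus, ‖VV K b t x * VV K c t x‖ₑ ^ 2
      ≤ ENNReal.ofReal (2 * Real.pi) * (ENNReal.ofReal (2 * Real.pi) *
        (((94 * 16 ^ n : ℕ) : ℝ≥0∞) * (((512 * 256 ^ m : ℕ) : ℝ≥0∞) *
        ((∑ k ∈ K, ∫⁻ σ, ‖b k σ‖ₑ ^ 2) * (∑ k ∈ K, ∫⁻ σ, ‖c k σ‖ₑ ^ 2))))) := by
  classical
  set y : ℤ × ℤ → ℝ → ℂ := fun p => b p.1 ⋆[ContinuousLinearMap.mul ℂ ℂ] c p.2 with hy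
  set J : Finset ℤ := (K ×ˢ K).image (fun p => p.1 + p.2) with hJ
  set P : ℤ → Finset (ℤ × ℤ) := fun j => (K ×ˢ K).filter (fun p => p.1 + p.2 = j) with hP
  set h : ℤ → ℝ → ℂ := fun j σ => ∑ p ∈ P j, y p σ with hh
  have yint : ∀ p, Integrable (y p) := fun p =>
    (hb p.1).int.integrable_convolution _ (hc p.2).int
  -- L2 bound for y
  have ysq : ∀ p, ∫⁻ σ, ‖y p σ‖ₑ ^ 2 ≤ ((512 * 256 ^ m : ℕ) : ℝ≥0∞) *
      ((∫⁻ σ, ‖b p.1 σ‖ₑ ^ 2) * ∫⁻ σ, ‖c p.2 σ‖ₑ ^ 2) := by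
    intro p
    have hbm := (hb p.1).meas
    have hcm := (hc p.2).meas
    rw [← conv_L2 _ _ hbm hcm, ← lintegral_const_mul _ (by fun_prop)]
    refine lintegral_mono fun σ => ?_
    refine (conv_sq _ _ hbm hcm (Set.Icc (-(p.1:ℝ) ^ 2 - 256 ^ (m + 1)) (-(p.1:ℝ) ^ 2 + 256 ^ (m + 1)))
      measurableSet_Icc ?_ σ).trans ?_
    · intro s hs
      by_contra hne
      have := abs_le.1 (hbs p.1 s hne)
      exact hs ⟨by linarith [this.1], by linarith [this.2]⟩
    · gcongr
      rw [Real.volume_Icc, ← ENNReal.ofReal_natCast]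
      apply ENNReal.ofReal_le_ofReal
      push_cast
      rw [pow_succ]
      apply le_of_eq; ring
  have ysqfin : ∀ p, ∫⁻ σ, ‖y p σ‖ₑ ^ 2 < ∞ := fun p =>
    (ysq p).trans_lt (ENNReal.mul_lt_top (ENNReal.natCast_lt_top _)
      (ENNReal.mul_lt_top (hb _).fin (hc _).fin))
  have yl2 : ∀ p, MemLp (y p) 2 := fun p => by
    refine ⟨(yint p).aestronglyMeasurable, ?_⟩
    rw [eLpNorm_lt_top_iff_lintegral_rpow_enorm_lt_top (by norm_num) (by norm_num)]
    simpa using ysqfin p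
  have hInt0 : ∀ j, Integrable (h j) := fun j => integrable_finsetSum _ fun p _ => yint p
  have hl2 : ∀ j, MemLp (h j) 2 := fun j => memLp_finsetSum _ fun p _ => yl2 p
  have step1 : ∀ t, ∫⁻ x : Torus, ‖VV K b t x * VV K c t x‖ₑ ^ 2
      = ENNReal.ofReal (2 * Real.pi) * ∑ j ∈ J, ‖EE (h j) t‖ₑ ^ 2 := by
    intro t
    rw [← parseval_torus]
    congr 1; ext x; congr 2
    unfold VV
    rw [Finset.sum_mul_sum, ← Finset.sum_product',
      ← Finset.sum_fiberwise_of_maps_to (t := J) (g := fun p : ℤ × ℤ => p.1 + p.2)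
        (fun p hp => Finset.mem_image_of_mem _ hp)]
    refine Finset.sum_congr rfl fun j _ => ?_
    rw [hh, EE_sum _ _ (fun p _ => yint p), Finset.sum_mul]
    refine Finset.sum_congr rfl fun p hp => ?_
    rw [hy, EE_conv _ _ (hb _).int (hc _).int, ← (Finset.mem_filter.1 hp).2, fourier_add]
    ring
  have hmeasEE : ∀ j, Measurable (EE (h j)) := fun j => (EE_continuous _ (hInt0 j)).measurable
  simp_rw [step1]
  rw [lintegral_const_mul _ (by fun_prop), lintegral_finsetSum _ (by fun_prop)]
  gcongr
  have step2 : ∀ j, ∫⁻ t, ‖EE (h j) t‖ₑ ^ 2 = ENNReal.ofReal (2 * Real.pi) * ∫⁻ t, ‖h j t‖ₑ ^ 2 := by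
    intro j
    simpa using EE_plancherel (h j) (hInt0 j) (hl2 j)
  simp_rw [step2]
  rw [← Finset.mul_sum]
  gcongr
  have step3 : ∀ j, ∫⁻ σ, ‖h j σ‖ₑ ^ 2
      ≤ ((94 * 16 ^ n : ℕ) : ℝ≥0∞) * ∑ p ∈ P j, ∫⁻ σ, ‖y p σ‖ₑ ^ 2 := by
    intro j
    rw [← lintegral_finsetSum' _ (fun p _ => by
        have := (yint p).aestronglyMeasurable.enorm; fun_prop),
      ← lintegral_const_mul' _ _ (ENNReal.natCast_ne_top _)]
    refine lintegral_mono fun σ => ?_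
    refine enorm_sum_sq_le _ _ _ ?_
    refine count_pairs _ j σ n ?_
    intro p hp
    rw [Finset.mem_filter, Finset.mem_filter] at hp
    refine ⟨hp.1.2, ?_⟩
    have hne := hp.2
    have : ∃ s, b p.1 s ≠ 0 ∧ c p.2 (σ - s) ≠ 0 := by
      by_contra hcon
      push Not at hcon
      apply hne
      rw [hy]
      simp only [convolution_def]
      refine integral_eq_zero_of_ae (Eventually.of_forall fun s => ?_)
      by_cases hs : b p.1 s = 0
      · simp [hs]
      · simp [hcon s hs]
    obtain ⟨s, hs1, hs2⟩ := this
    have h1 := hbs _ _ hs1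
    have h2 := hcs _ _ hs2
    have h3 : (256:ℝ) ^ (m + 1) ≤ 256 ^ (n + 1) := by
      gcongr; norm_num
    have h4 : σ + (p.1:ℝ) ^ 2 + (p.2:ℝ) ^ 2 = (s + (p.1:ℝ) ^ 2) + ((σ - s) + (p.2:ℝ) ^ 2) := by ring
    rw [h4]
    refine (abs_add_le _ _).trans ?_
    linarith
  calc _ ≤ ∑ j ∈ J, ((94 * 16 ^ n : ℕ) : ℝ≥0∞) * ∑ p ∈ P j, (((512 * 256 ^ m : ℕ) : ℝ≥0∞) *
      ((∫⁻ σ, ‖b p.1 σ‖ₑ ^ 2) * ∫⁻ σ, ‖c p.2 σ‖ₑ ^ 2)) := by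
        refine Finset.sum_le_sum fun j _ => (step3 j).trans ?_
        gcongr with p hp
        exact ysq p
    _ = _ := by
        rw [← Finset.mul_sum, Finset.sum_fiberwise_of_maps_to (t := J) (g := fun p : ℤ × ℤ => p.1 + p.2)
          (fun p hp => Finset.mem_image_of_mem _ hp), ← Finset.mul_sum, Finset.sum_mul_sum,
          ← Finset.sum_product']

lemma jb_one_le (x : ℝ) : 1 ≤ jb x := by
  unfold jb
  rw [Real.one_le_sqrt]
  nlinarith [sq_nonneg x]

lemma jb_abs_le (x : ℝ) : |x| ≤ jb x := by
  unfold jb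
  apply Real.abs_le_sqrt
  linarith

lemma jb_continuous : Continuous jb := by unfold jb; fun_prop

lemma geom_half_le (M : ℕ) : ∑ i ∈ Finset.range M, (2⁻¹ : ℝ≥0∞) ^ i ≤ 2 := by
  refine (ENNReal.sum_le_tsum _).trans (le_of_eq ?_)
  rw [ENNReal.tsum_geometric, ENNReal.one_sub_inv_two, inv_inv]

lemma geom_two_sided (M m : ℕ) :
    ∑ n ∈ Finset.range M, (2⁻¹ : ℝ≥0∞) ^ ((m - n) + (n - m)) ≤ 4 := by
  calc _ ≤ ∑ n ∈ Finset.range ((m + 1) + M), (2⁻¹ : ℝ≥0∞) ^ ((m - n) + (n - m)) := by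
        apply Finset.sum_le_sum_of_subset
        intro x hx; simp at hx ⊢; omega
    _ = ∑ n ∈ Finset.range (m + 1), (2⁻¹ : ℝ≥0∞) ^ ((m - n) + (n - m))
        + ∑ i ∈ Finset.range M, (2⁻¹ : ℝ≥0∞) ^ ((m - (m + 1 + i)) + ((m + 1 + i) - m)) :=
        Finset.sum_range_add _ _ _
    _ ≤ 2 + 2 := by
        gcongr
        · rw [← Finset.sum_range_reflect]
          refine le_trans (Finset.sum_le_sum fun i hi => ?_) (geom_half_le (m + 1))
          rw [Finset.mem_range] at hi
          apply le_of_eq; congr 1; omega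
        · refine le_trans (Finset.sum_le_sum fun i hi => ?_) (geom_half_le M)
          apply pow_le_pow_right_of_le_one' (by simp)
          omega
    _ = 4 := by norm_num

lemma schur_sum (M : ℕ) (β : ℕ → ℝ≥0∞) :
    ∑ m ∈ Finset.range M, ∑ n ∈ Finset.range M, (2⁻¹ : ℝ≥0∞) ^ ((m - n) + (n - m)) * (β m * β n)
      ≤ 8 * ∑ m ∈ Finset.range M, β m ^ 2 := by
  have h1 : ∀ m n, β m * β n ≤ β m ^ 2 + β n ^ 2 := by
    intro m n
    rcases le_total (β m) (β n) with h | h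
    · calc β m * β n ≤ β n * β n := by gcongr
        _ = β n ^ 2 := by ring
        _ ≤ _ := le_add_self
    · calc β m * β n ≤ β m * β m := by gcongr
        _ = β m ^ 2 := by ring
        _ ≤ _ := le_self_add
  calc _ ≤ ∑ m ∈ Finset.range M, ∑ n ∈ Finset.range M,
        ((2⁻¹ : ℝ≥0∞) ^ ((m - n) + (n - m)) * β m ^ 2 + (2⁻¹ : ℝ≥0∞) ^ ((m - n) + (n - m)) * β n ^ 2) := by
        gcongr with m _ n _
        rw [← mul_add]
        gcongr
        exact h1 m n
    _ = (∑ m ∈ Finset.range M, (∑ n ∈ Finset.range M, (2⁻¹ : ℝ≥0∞) ^ ((m - n) + (n - m))) * β m ^ 2)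
      + (∑ n ∈ Finset.range M, (∑ m ∈ Finset.range M, (2⁻¹ : ℝ≥0∞) ^ ((n - m) + (m - n))) * β n ^ 2) := by
        simp_rw [Finset.sum_add_distrib]
        congr 1
        · simp_rw [Finset.sum_mul]
        · rw [Finset.sum_comm]
          simp_rw [Finset.sum_mul]
          refine Finset.sum_congr rfl fun n _ => Finset.sum_congr rfl fun m _ => ?_
          rw [add_comm]
    _ ≤ (∑ m ∈ Finset.range M, 4 * β m ^ 2) + (∑ m ∈ Finset.range M, 4 * β m ^ 2) := by
        gcongr with m _ m _
        · exact geom_two_sided M m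
        · exact geom_two_sided M m
    _ = _ := by
        rw [← Finset.mul_sum, ← add_mul]; norm_num

/-- dyadic (base 256) modulation piece -/
def piece (a : ℤ → ℝ → ℂ) (m : ℕ) (k : ℤ) (σ : ℝ) : ℂ :=
  if 256 ^ m ≤ jb (σ + (k:ℝ) ^ 2) ∧ jb (σ + (k:ℝ) ^ 2) < 256 ^ (m + 1) then a k σ else 0

/-- weighting -/
def wt (a : ℤ → ℝ → ℂ) (k : ℤ) (σ : ℝ) : ℂ :=
  ((jb (σ + (k:ℝ) ^ 2) ^ (-(3/8 : ℝ)) : ℝ) : ℂ) * a k σ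

lemma jb_shift_meas (k : ℤ) : Measurable (fun σ : ℝ => jb (σ + (k:ℝ) ^ 2)) := by
  have := jb_continuous.measurable
  fun_prop

lemma Nice.of_le {f g : ℝ → ℂ} (hf : Nice f) (hg : Measurable g) (h : ∀ σ, ‖g σ‖ ≤ ‖f σ‖) : Nice g :=
  ⟨hg, hf.int.mono hg.aestronglyMeasurable (Eventually.of_forall h),
    hf.l2.mono hg.aestronglyMeasurable (Eventually.of_forall h)⟩

lemma piece_nice {a : ℤ → ℝ → ℂ} (ha : ∀ k, Nice (a k)) (m : ℕ) (k : ℤ) : Nice (piece a m k) := by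
  refine (ha k).of_le ?_ ?_
  · unfold piece
    refine Measurable.ite ?_ (ha k).meas measurable_const
    exact (measurableSet_le measurable_const (jb_shift_meas k)).inter
      (measurableSet_lt (jb_shift_meas k) measurable_const)
  · intro σ
    unfold piece
    split_ifs <;> simp

lemma wt_nice {a : ℤ → ℝ → ℂ} (ha : ∀ k, Nice (a k)) (k : ℤ) : Nice (wt a k) := by
  refine (ha k).of_le ?_ ?_
  · unfold wt
    have h1 := jb_shift_meas k
    have h2 := (ha k).meas
    fun_prop
  · intro σ
    unfold wt
    have h1 := jb_one_le (σ + (k:ℝ) ^ 2)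
    rw [norm_mul, Complex.norm_real, Real.norm_of_nonneg (by positivity)]
    have : jb (σ + (k:ℝ) ^ 2) ^ (-(3/8 : ℝ)) ≤ 1 := Real.rpow_le_one_of_one_le_of_nonpos h1 (by norm_num)
    nlinarith [norm_nonneg (a k σ)]

lemma wt_piece_sq (a : ℤ → ℝ → ℂ) (m : ℕ) (k : ℤ) (σ : ℝ) :
    ‖wt (piece a m) k σ‖ₑ ^ 2 ≤ ENNReal.ofReal ((1/64) ^ m) * ‖piece a m k σ‖ₑ ^ 2 := by
  by_cases h : 256 ^ m ≤ jb (σ + (k:ℝ) ^ 2)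
  · unfold wt
    rw [enorm_mul, mul_pow]
    gcongr
    have h0 : (0:ℝ) ≤ jb (σ + (k:ℝ) ^ 2) ^ (-(3/8 : ℝ)) := by
      have := jb_one_le (σ + (k:ℝ) ^ 2)
      positivity
    have h1 : jb (σ + (k:ℝ) ^ 2) ^ (-(3/8 : ℝ)) ≤ (1/8) ^ m := by
      calc _ ≤ ((256:ℝ) ^ m) ^ (-(3/8 : ℝ)) :=
            Real.rpow_le_rpow_of_nonpos (by positivity) h (by norm_num)
        _ = ((256:ℝ) ^ (-(3/8 : ℝ))) ^ m := by
            rw [← Real.rpow_natCast, ← Real.rpow_mul (by norm_num), mul_comm, Real.rpow_mul (by norm_num),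
              Real.rpow_natCast]
        _ = (1/8) ^ m := by
            congr 1
            rw [show (256:ℝ) = 2 ^ (8:ℝ) by norm_num, ← Real.rpow_mul (by norm_num)]
            norm_num
    rw [← ofReal_norm, Complex.norm_real, Real.norm_of_nonneg h0, ← ENNReal.ofReal_pow h0]
    apply ENNReal.ofReal_le_ofReal
    calc _ ≤ (((1:ℝ)/8) ^ m) ^ 2 := by gcongr
      _ = _ := by rw [← pow_mul, mul_comm, pow_mul]; norm_num
  · have : piece a m k σ = 0 := by
      unfold piece; rw [if_neg]; tauto
    simp [wt, this]

/-- mass of piece -/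
def mass (K : Finset ℤ) (a : ℤ → ℝ → ℂ) : ℝ≥0∞ := ∑ k ∈ K, ∫⁻ σ, ‖a k σ‖ₑ ^ 2

lemma mass_wt_piece (K : Finset ℤ) (a : ℤ → ℝ → ℂ) (m : ℕ) :
    mass K (wt (piece a m)) ≤ ENNReal.ofReal ((1/64) ^ m) * mass K (piece a m) := by
  unfold mass
  rw [Finset.mul_sum]
  gcongr with k _
  rw [← lintegral_const_mul' _ _ ENNReal.ofReal_ne_top]
  exact lintegral_mono fun σ => wt_piece_sq a m k σ

/-- the constant -/
def c0 : ℝ := (2 * Real.pi) ^ 2 * 94 * 512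

lemma c0_nonneg : 0 ≤ c0 := by unfold c0; positivity

lemma bilin_piece_le (K : Finset ℤ) (a : ℤ → ℝ → ℂ) (ha : ∀ k, Nice (a k)) (m n : ℕ) (hmn : m ≤ n) :
    ∫⁻ t, ∫⁻ x : Torus, ‖VV K (wt (piece a m)) t x * VV K (wt (piece a n)) t x‖ₑ ^ 2
      ≤ ENNReal.ofReal (c0 * (1/4) ^ ((m - n) + (n - m))) * (mass K (piece a m) * mass K (piece a n)) := by
  have hs : ∀ m k σ, wt (piece a m) k σ ≠ 0 → |σ + (k:ℝ) ^ 2| ≤ 256 ^ (m + 1) := by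
    intro m k σ hne
    have h1 : piece a m k σ ≠ 0 := by
      intro h; apply hne; simp [wt, h]
    have h2 : jb (σ + (k:ℝ) ^ 2) < 256 ^ (m + 1) := by
      by_contra h; apply h1; unfold piece; rw [if_neg]; tauto
    exact (jb_abs_le _).trans h2.le
  refine (bilin K _ _ (wt_nice (piece_nice ha m)) (wt_nice (piece_nice ha n)) m n hmn (hs m) (hs n)).trans ?_
  change _ * (_ * (_ * (_ * (mass K (wt (piece a m)) * mass K (wt (piece a n)))))) ≤ _
  calc _ ≤ ENNReal.ofReal (2 * Real.pi) * (ENNReal.ofReal (2 * Real.pi) *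
        (((94 * 16 ^ n : ℕ) : ℝ≥0∞) * (((512 * 256 ^ m : ℕ) : ℝ≥0∞) *
        ((ENNReal.ofReal ((1/64) ^ m) * mass K (piece a m)) *
          (ENNReal.ofReal ((1/64) ^ n) * mass K (piece a n)))))) := by
        gcongr
        · exact mass_wt_piece K a m
        · exact mass_wt_piece K a n
    _ = (ENNReal.ofReal (2 * Real.pi) * ENNReal.ofReal (2 * Real.pi) *
        ((94 * 16 ^ n : ℕ) : ℝ≥0∞) * ((512 * 256 ^ m : ℕ) : ℝ≥0∞) *
        ENNReal.ofReal ((1/64) ^ m) * ENNReal.ofReal ((1/64) ^ n)) *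
          (mass K (piece a m) * mass K (piece a n)) := by ring
    _ = _ := by
        congr 1
        rw [← ENNReal.ofReal_natCast, ← ENNReal.ofReal_natCast, ← ENNReal.ofReal_mul (by positivity),
          ← ENNReal.ofReal_mul (by positivity), ← ENNReal.ofReal_mul (by positivity),
          ← ENNReal.ofReal_mul (by positivity), ← ENNReal.ofReal_mul (by positivity)]
        congr 1
        obtain ⟨d, rfl⟩ := Nat.exists_eq_add_of_le hmn
        have e : (m - (m + d)) + (m + d - m) = d := by omega
        rw [e]
        unfold c0
        push_cast
        have e1 : (16:ℝ) ^ m * 256 ^ m * ((1/64) ^ m * (1/64) ^ m) = 1 := by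
          rw [← mul_pow, ← mul_pow, ← mul_pow]; norm_num
        have e2 : (16:ℝ) ^ d * (1/64) ^ d = (1/4) ^ d := by
          rw [← mul_pow]; norm_num
        rw [pow_add, pow_add, ← e2]
        linear_combination ((2 * Real.pi) ^ 2 * 94 * 512 * ((16:ℝ) ^ d * (1/64) ^ d)) * e1

lemma bilin_piece (K : Finset ℤ) (a : ℤ → ℝ → ℂ) (ha : ∀ k, Nice (a k)) (m n : ℕ) :
    ∫⁻ t, ∫⁻ x : Torus, ‖VV K (wt (piece a m)) t x * VV K (wt (piece a n)) t x‖ₑ ^ 2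
      ≤ ENNReal.ofReal (c0 * (1/4) ^ ((m - n) + (n - m))) * (mass K (piece a m) * mass K (piece a n)) := by
  rcases le_total m n with h | h
  · exact bilin_piece_le K a ha m n h
  · have := bilin_piece_le K a ha n m h
    rw [add_comm (m - n), mul_comm (mass K (piece a m))]
    simp_rw [mul_comm (VV K (wt (piece a m)) _ _)]
    exact this

lemma VV_continuous (K : Finset ℤ) (b : ℤ → ℝ → ℂ) (hb : ∀ k, Nice (b k)) :
    Continuous (fun z : ℝ × Torus => VV K b z.1 z.2) := by
  unfold VV
  refine continuous_finsetSum _ fun k _ => ?_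
  have h1 := EE_continuous _ (hb k).int
  have h2 : Continuous (fun x : Torus => fourier k x) := (fourier k).continuous
  exact (h1.comp continuous_fst).mul (h2.comp continuous_snd)

lemma exists_level (M : ℕ) (y : ℝ) (h1 : 1 ≤ y) (h2 : y < 256 ^ M) :
    ∃ m, m < M ∧ 256 ^ m ≤ y ∧ y < 256 ^ (m + 1) := by
  induction M with
  | zero => simp at h2; linarith
  | succ M ih =>
    by_cases h : y < 256 ^ M
    · obtain ⟨m, hm, h3⟩ := ih h
      exact ⟨m, by omega, h3⟩
    · exact ⟨M, by omega, not_lt.1 h, h2⟩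

lemma level_unique {m n : ℕ} {y : ℝ} (h1 : 256 ^ m ≤ y) (h2 : y < 256 ^ (n + 1)) : m ≤ n := by
  have h : (256:ℝ) ^ m < 256 ^ (n + 1) := h1.trans_lt h2
  have := (pow_lt_pow_iff_right₀ (by norm_num : (1:ℝ) < 256)).1 h
  omega

lemma piece_cases (a : ℤ → ℝ → ℂ) (M : ℕ) (k : ℤ) (σ : ℝ)
    (hM : a k σ ≠ 0 → jb (σ + (k:ℝ) ^ 2) < 256 ^ M) :
    (∀ m, piece a m k σ = 0) ∧ a k σ = 0 ∨
    ∃ m, m < M ∧ piece a m k σ = a k σ ∧ ∀ n, n ≠ m → piece a n k σ = 0 := by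
  by_cases h : a k σ = 0
  · left
    refine ⟨fun m => ?_, h⟩
    simp [piece, h]
  · right
    obtain ⟨m, hm, h1, h2⟩ := exists_level M _ (jb_one_le _) (hM h)
    refine ⟨m, hm, ?_, ?_⟩
    · simp [piece, h1, h2]
    · intro n hn
      unfold piece
      rw [if_neg]
      rintro ⟨h3, h4⟩
      exact hn (le_antisymm (level_unique h3 h2) (level_unique h1 h4))

lemma piece_sum (a : ℤ → ℝ → ℂ) (M : ℕ) (k : ℤ) (σ : ℝ)
    (hM : a k σ ≠ 0 → jb (σ + (k:ℝ) ^ 2) < 256 ^ M) :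
    ∑ m ∈ Finset.range M, piece a m k σ = a k σ := by
  rcases piece_cases a M k σ hM with ⟨h1, h2⟩ | ⟨m, hm, h1, h2⟩
  · simp [h1, h2]
  · rw [Finset.sum_eq_single_of_mem m (Finset.mem_range.2 hm) (fun n _ hn => h2 n hn), h1]

lemma piece_sum_sq (a : ℤ → ℝ → ℂ) (M : ℕ) (k : ℤ) (σ : ℝ)
    (hM : a k σ ≠ 0 → jb (σ + (k:ℝ) ^ 2) < 256 ^ M) :
    ∑ m ∈ Finset.range M, ‖piece a m k σ‖ₑ ^ 2 = ‖a k σ‖ₑ ^ 2 := by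
  rcases piece_cases a M k σ hM with ⟨h1, h2⟩ | ⟨m, hm, h1, h2⟩
  · simp [h1, h2]
  · rw [Finset.sum_eq_single_of_mem m (Finset.mem_range.2 hm) (fun n _ hn => by simp [h2 n hn]), h1]

lemma mass_sum (K : Finset ℤ) (a : ℤ → ℝ → ℂ) (ha : ∀ k, Nice (a k)) (M : ℕ)
    (hM : ∀ k σ, a k σ ≠ 0 → jb (σ + (k:ℝ) ^ 2) < 256 ^ M) :
    ∑ m ∈ Finset.range M, mass K (piece a m) = mass K a := by
  unfold mass
  rw [Finset.sum_comm]
  refine Finset.sum_congr rfl fun k _ => ?_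
  rw [← lintegral_finsetSum _ (fun m _ => by
    have := (piece_nice ha m k).meas; fun_prop)]
  congr 1; ext σ
  exact piece_sum_sq a M k σ (hM k σ)

lemma VV_sum (K : Finset ℤ) (a : ℤ → ℝ → ℂ) (ha : ∀ k, Nice (a k)) (M : ℕ)
    (hM : ∀ k σ, a k σ ≠ 0 → jb (σ + (k:ℝ) ^ 2) < 256 ^ M) (t : ℝ) (x : Torus) :
    VV K (wt a) t x = ∑ m ∈ Finset.range M, VV K (wt (piece a m)) t x := by
  unfold VV
  rw [Finset.sum_comm]
  refine Finset.sum_congr rfl fun k _ => ?_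
  rw [← Finset.sum_mul, ← EE_sum _ _ (fun m _ => (wt_nice (piece_nice ha m) k).int)]
  congr 2
  ext σ
  unfold wt
  rw [← Finset.mul_sum, piece_sum a M k σ (hM k σ)]

lemma eLpNorm_two_sq {α : Type*} [MeasurableSpace α] (μ : Measure α) (f : α → ℂ) :
    eLpNorm f 2 μ ^ 2 = ∫⁻ z, ‖f z‖ₑ ^ 2 ∂μ := by
  rw [eLpNorm_eq_lintegral_rpow_enorm_toReal (by norm_num) (by norm_num),
      ← ENNReal.rpow_natCast, ← ENNReal.rpow_mul]
  norm_num

lemma L4_est (K : Finset ℤ) (a : ℤ → ℝ → ℂ) (ha : ∀ k, Nice (a k)) (M : ℕ)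
    (hM : ∀ k σ, a k σ ≠ 0 → jb (σ + (k:ℝ) ^ 2) < 256 ^ M) :
    ∫⁻ t, ∫⁻ x : Torus, ‖VV K (wt a) t x‖ₑ ^ 4
      ≤ ENNReal.ofReal (64 * c0) * mass K a ^ 2 := by
  set μ : Measure (ℝ × Torus) := (volume : Measure ℝ).prod (volume : Measure Torus) with hμ
  set v : ℕ → ℝ × Torus → ℂ := fun m z => VV K (wt (piece a m)) z.1 z.2 with hv
  have hvc : ∀ m, Continuous (v m) := fun m => VV_continuous K _ (wt_nice (piece_nice ha m))
  set V : ℝ × Torus → ℂ := fun z => VV K (wt a) z.1 z.2 with hV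
  have hVc : Continuous V := VV_continuous K _ (wt_nice ha)
  have hVsum : ∀ z, V z = ∑ m ∈ Finset.range M, v m z := fun z => VV_sum K a ha M hM z.1 z.2
  have e1 : ∫⁻ t, ∫⁻ x : Torus, ‖VV K (wt a) t x‖ₑ ^ 4 = eLpNorm (fun z => V z * V z) 2 μ ^ 2 := by
    rw [eLpNorm_two_sq, hμ, lintegral_prod _ (by
      have := hVc.measurable; fun_prop)]
    congr 1; ext t; congr 1; ext x
    rw [enorm_mul]; ring
  have hmn : ∀ m n, eLpNorm (fun z => v m z * v n z) 2 μ ≤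
      ENNReal.ofReal (Real.sqrt c0) * ((2⁻¹) ^ ((m - n) + (n - m)) *
        (mass K (piece a m) ^ (1/2 : ℝ) * mass K (piece a n) ^ (1/2 : ℝ))) := by
    intro m n
    have hsq : ∀ y : ℝ≥0∞, (y ^ (1/2 : ℝ)) ^ 2 = y := fun y => by
      rw [← ENNReal.rpow_natCast, ← ENNReal.rpow_mul]; norm_num
    rw [← ENNReal.pow_le_pow_left_iff (n := 2) (by norm_num)]
    rw [eLpNorm_two_sq, hμ, lintegral_prod _ (by
      have h1 := (hvc m).measurable; have h2 := (hvc n).measurable; fun_prop)]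
    refine (bilin_piece K a ha m n).trans (le_of_eq ?_)
    rw [mul_pow, mul_pow, mul_pow, hsq, hsq, ENNReal.ofReal_mul c0_nonneg, mul_assoc]
    congr 1
    · rw [← ENNReal.ofReal_pow (Real.sqrt_nonneg _), Real.sq_sqrt c0_nonneg]
    · congr 1
      rw [← pow_mul, mul_comm _ 2, pow_mul, ENNReal.ofReal_pow (by norm_num)]
      congr 1
      rw [one_div, ENNReal.ofReal_inv_of_pos (by norm_num), ← ENNReal.inv_pow]
      norm_num
  have e2 : eLpNorm (fun z => V z * V z) 2 μ ≤
      ENNReal.ofReal (Real.sqrt c0) * (8 * mass K a) := by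
    have : (fun z => V z * V z) = ∑ m ∈ Finset.range M, ∑ n ∈ Finset.range M, fun z => v m z * v n z := by
      ext z
      rw [hVsum, Finset.sum_mul_sum]
      simp [Finset.sum_apply]
    rw [this]
    have hms : ∀ m n, AEStronglyMeasurable (fun z => v m z * v n z) μ := fun m n =>
      ((hvc m).mul (hvc n)).aestronglyMeasurable
    calc _ ≤ ∑ m ∈ Finset.range M, eLpNorm (∑ n ∈ Finset.range M, fun z => v m z * v n z) 2 μ :=
          eLpNorm_sum_le (fun m _ => Finset.aestronglyMeasurable_sum _ fun n _ => hms m n) (by norm_num)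
      _ ≤ ∑ m ∈ Finset.range M, ∑ n ∈ Finset.range M, eLpNorm (fun z => v m z * v n z) 2 μ := by
          gcongr with m _
          exact eLpNorm_sum_le (fun n _ => hms m n) (by norm_num)
      _ ≤ ∑ m ∈ Finset.range M, ∑ n ∈ Finset.range M,
        ENNReal.ofReal (Real.sqrt c0) * ((2⁻¹) ^ ((m - n) + (n - m)) *
        (mass K (piece a m) ^ (1/2 : ℝ) * mass K (piece a n) ^ (1/2 : ℝ))) := by
          gcongr with m _ n _
          exact hmn m n
      _ ≤ _ := by
          simp_rw [← Finset.mul_sum]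
          gcongr
          refine (schur_sum M (fun m => mass K (piece a m) ^ (1/2 : ℝ))).trans ?_
          gcongr
          rw [← mass_sum K a ha M hM]
          refine Finset.sum_le_sum fun m _ => le_of_eq ?_
          rw [← ENNReal.rpow_natCast, ← ENNReal.rpow_mul]; norm_num
  rw [e1]
  calc _ ≤ (ENNReal.ofReal (Real.sqrt c0) * (8 * mass K a)) ^ 2 := by gcongr
    _ = _ := by
      rw [mul_pow, mul_pow, ← ENNReal.ofReal_pow (Real.sqrt_nonneg _), Real.sq_sqrt c0_nonneg,
        ENNReal.ofReal_mul (by norm_num), ← mul_assoc]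
      congr 1
      rw [mul_comm]
      congr 1
      norm_num

/-- coefficient -/
def cf (u : ℝ → Torus → ℂ) (k : ℤ) (t : ℝ) : ℂ := (2 * Real.pi) * fourierCoeff (u t) k

lemma stFT_eq (u : ℝ → Torus → ℂ) (σ : ℝ) (k : ℤ) : stFT u σ k = EE (cf u k) (-σ) := by
  unfold stFT EE cf
  congr 1; ext t; congr 2; push_cast; ring

lemma stFT_zero (u : ℝ → Torus → ℂ) (k : ℤ) (h : ¬ Integrable (cf u k)) (σ : ℝ) : stFT u σ k = 0 := by
  unfold stFT
  apply integral_undef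
  intro h2
  apply h
  have h3 := h2.bdd_mul (f := fun t : ℝ => Complex.exp (Complex.I * σ * t)) (c := 1)
    (by fun_prop) (Eventually.of_forall fun t => by rw [Complex.norm_exp]; simp)
  refine h3.congr (Eventually.of_forall fun t => ?_)
  simp only
  rw [← mul_assoc, ← Complex.exp_add]
  have : Complex.I * σ * t + -Complex.I * σ * t = 0 := by ring
  rw [this, Complex.exp_zero, one_mul]
  rfl

lemma stFT_continuous (u : ℝ → Torus → ℂ) (k : ℤ) : Continuous (fun σ => stFT u σ k) := by
  by_cases h : Integrable (cf u k)
  · simp_rw [stFT_eq]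
    exact (EE_continuous _ h).comp continuous_neg
  · simp_rw [stFT_zero u k h]
    exact continuous_const

lemma pairing_le (f : Torus → ℂ) (K : Finset ℤ) (d : ℤ → ℂ) :
    ‖∑ k ∈ K, (2 * Real.pi * fourierCoeff f k) * (starRingEnd ℂ) (d k)‖ₑ
      ≤ (∫⁻ x : Torus, ‖f x‖ₑ ^ (4/3 : ℝ)) ^ (3/4 : ℝ) *
        (∫⁻ x : Torus, ‖∑ k ∈ K, d k * fourier k x‖ₑ ^ (4 : ℝ)) ^ (1/4 : ℝ) := by
  have hcont : ∀ k : ℤ, Continuous (fun x : Torus => fourier k x) := fun k => (fourier k).continuous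
  have hF : ∀ k, (2 * Real.pi : ℂ) * fourierCoeff f k = ∫ x : Torus, fourier (-k) x * f x := by
    intro k
    unfold fourierCoeff
    rw [AddCircle.integral_haarAddCircle]
    simp only [smul_eq_mul, Complex.real_smul]
    have : (2 * Real.pi : ℂ) ≠ 0 := by
      simp [Real.pi_ne_zero]
    push_cast
    rw [← mul_assoc, mul_inv_cancel₀ this, one_mul]
  have hnorm : ∀ (k : ℤ) (x : Torus), ‖fourier k x‖ = 1 := fun k x => by
    rw [fourier_apply]; exact Circle.norm_coe _
  by_cases hf : Integrable f
  · have hInt0 : ∀ k, Integrable (fun x : Torus => fourier (-k) x * f x) := fun k =>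
      hf.bdd_mul (c := 1) (hcont _).aestronglyMeasurable
        (Eventually.of_forall fun x => (hnorm _ x).le)
    have e1 : ∑ k ∈ K, (2 * Real.pi * fourierCoeff f k) * (starRingEnd ℂ) (d k)
        = ∫ x : Torus, f x * (starRingEnd ℂ) (∑ k ∈ K, d k * fourier k x) := by
      simp_rw [hF, ← integral_mul_const]
      rw [← integral_finsetSum _ (fun k _ => (hInt0 k).mul_const _)]
      congr 1; ext x
      rw [map_sum, Finset.mul_sum]
      refine Finset.sum_congr rfl fun k _ => ?_
      rw [map_mul, fourier_neg]; ring
    rw [e1]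
    refine (enorm_integral_le_lintegral_enorm _).trans ?_
    have hpq : Real.HolderConjugate (4/3) 4 := by
      rw [Real.holderConjugate_iff]; norm_num
    have hV : Continuous (fun x : Torus => ∑ k ∈ K, d k * fourier k x) :=
      continuous_finsetSum _ fun k _ => continuous_const.mul (hcont k)
    have := ENNReal.lintegral_mul_le_Lp_mul_Lq volume hpq (f := fun x => ‖f x‖ₑ)
      (g := fun x : Torus => ‖∑ k ∈ K, d k * fourier k x‖ₑ)
      hf.aestronglyMeasurable.enorm hV.measurable.enorm.aemeasurable
    rw [show (1 / (4/3) : ℝ) = 3/4 by norm_num] at this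
    refine le_trans (le_of_eq ?_) this
    congr 1; ext x
    rw [enorm_mul, Pi.mul_apply]
    congr 1
    rw [← ofReal_norm, ← ofReal_norm, RCLike.norm_conj]
  · have h0 : ∀ k, (2 * Real.pi : ℂ) * fourierCoeff f k = 0 := by
      intro k
      rw [hF]
      apply integral_undef
      intro h2
      apply hf
      have h3 := h2.bdd_mul (f := fun x : Torus => fourier k x) (c := 1)
        (hcont k).aestronglyMeasurable (Eventually.of_forall fun x => (hnorm _ x).le)
      refine h3.congr (Eventually.of_forall fun x => ?_)
      simp only
      rw [← mul_assoc, ← fourier_add]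
      simp
    simp [h0]

/-- Hölder where only the second factor is measurable -/
lemma holder_lower (D G F : ℝ → ℝ≥0∞) (hD : AEMeasurable D) (hG : AEMeasurable G) (hGt : ∀ t, G t ≠ ∞)
    (h : ∀ t, D t ≤ F t * G t) :
    ∫⁻ t, D t ≤ (∫⁻ t, F t ^ (4/3 : ℝ)) ^ (3/4 : ℝ) * (∫⁻ t, G t ^ (4:ℝ)) ^ (1/4 : ℝ) := by
  have hpq : Real.HolderConjugate (4/3) 4 := by
    rw [Real.holderConjugate_iff]; norm_num
  have := ENNReal.lintegral_mul_le_Lp_mul_Lq volume hpq (f := fun t => D t / G t) (hD.div hG) hG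
  rw [show (1 / (4/3) : ℝ) = 3/4 by norm_num] at this
  calc ∫⁻ t, D t ≤ _ := by
        refine le_trans (lintegral_mono fun t => ?_) this
        by_cases h0 : G t = 0
        · have := h t
          rw [h0, mul_zero] at this
          exact this.trans zero_le
        · simp only [Pi.mul_apply]
          rw [ENNReal.div_mul_cancel h0 (hGt t)]
    _ ≤ _ := by
        gcongr with t
        exact ENNReal.div_le_of_le_mul (h t)

lemma cancel_sq (A B : ℝ≥0∞) (hA : A ≠ ∞) (h : A ≤ B * A ^ (1/2 : ℝ)) : A ≤ B ^ 2 := by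
  by_cases h0 : A = 0
  · simp [h0]
  · have h1 : A = A ^ (1/2 : ℝ) * A ^ (1/2 : ℝ) := by
      rw [← ENNReal.rpow_add _ _ h0 hA]; norm_num
    have h2 : A ^ (1/2 : ℝ) ≤ B := by
      have h3 : A ^ (1/2 : ℝ) * A ^ (1/2 : ℝ) ≤ B * A ^ (1/2 : ℝ) := by rw [← h1]; exact h
      refine (ENNReal.mul_le_mul_iff_left ?_ ?_).1 h3
      · simp [h0, hA]
      · simp [hA]
    rw [h1, sq]
    gcongr

lemma EE_norm_le (b : ℝ → ℂ) (t : ℝ) : ‖EE b t‖ ≤ ∫ s, ‖b s‖ := by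
  unfold EE
  refine (norm_integral_le_integral_norm _).trans (le_of_eq ?_)
  congr 1; ext s
  rw [norm_mul, Complex.norm_exp]; simp

lemma dual_EE (b c : ℝ → ℂ) (hb : Integrable b) (hc : Integrable c) :
    ∫ s, (starRingEnd ℂ) (b s) * EE c (-s) = ∫ t, c t * (starRingEnd ℂ) (EE b t) := by
  have hcb : Integrable (fun s => (starRingEnd ℂ) (b s)) := by
    refine hb.mono (Complex.continuous_conj.comp_aestronglyMeasurable hb.aestronglyMeasurable) ?_
    exact Eventually.of_forall fun s => by simp
  have h1 : ∀ s, (starRingEnd ℂ) (b s) * EE c (-s)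
      = ∫ t : ℝ, Complex.exp (-(Complex.I * s * t)) * ((starRingEnd ℂ) (b s) * c t) := by
    intro s
    unfold EE
    rw [← integral_const_mul]
    congr 1; ext t
    have : Complex.I * (t : ℂ) * ((-s : ℝ) : ℂ) = -(Complex.I * s * t) := by push_cast; ring
    rw [this]; ring
  have h2 : ∀ t, c t * (starRingEnd ℂ) (EE b t)
      = ∫ s : ℝ, Complex.exp (-(Complex.I * s * t)) * ((starRingEnd ℂ) (b s) * c t) := by
    intro t
    unfold EE
    rw [← integral_conj, ← integral_const_mul]
    congr 1; ext s
    rw [map_mul, ← Complex.exp_conj]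
    simp only [map_mul, Complex.conj_I, Complex.conj_ofReal]
    rw [show -Complex.I * (s : ℂ) * t = -(Complex.I * s * t) by ring]; ring
  simp_rw [h1, h2]
  apply integral_integral_swap
  have h3 := hcb.mul_prod hc
  refine h3.bdd_mul (f := fun z : ℝ × ℝ => Complex.exp (-(Complex.I * z.1 * z.2))) (c := 1)
    (by fun_prop) (Eventually.of_forall fun z => ?_)
  rw [Complex.norm_exp]; simp

/-- weighted transform -/
def gg (u : ℝ → Torus → ℂ) (k : ℤ) (σ : ℝ) : ℂ :=
  ((jb (σ + (k:ℝ)^2) ^ (-(3/8:ℝ)) : ℝ) : ℂ) * stFT u σ k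

lemma gg_continuous (u : ℝ → Torus → ℂ) (k : ℤ) : Continuous (gg u k) := by
  unfold gg
  refine Continuous.mul (Complex.continuous_ofReal.comp ?_) (stFT_continuous u k)
  refine Continuous.rpow_const (jb_continuous.comp (by fun_prop)) fun σ => Or.inl ?_
  have := jb_one_le (σ + (k:ℝ)^2)
  linarith

lemma nice_ind (g : ℝ → ℂ) (hg : Continuous g) (R : ℕ) :
    Nice ((Set.Icc (-(R:ℝ)) R).indicator g) := by
  obtain ⟨C, hC⟩ := (isCompact_Icc (a := -(R:ℝ)) (b := R)).exists_bound_of_continuousOn hg.continuousOn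
  refine ⟨hg.measurable.indicator measurableSet_Icc, ?_, ?_⟩
  · rw [integrable_indicator_iff measurableSet_Icc]
    exact hg.continuousOn.integrableOn_Icc
  · rw [memLp_indicator_iff_restrict measurableSet_Icc]
    exact MemLp.of_bound hg.aestronglyMeasurable C
      ((ae_restrict_iff' measurableSet_Icc).2 (Eventually.of_forall hC))

/-- truncated dual function -/
def aa (u : ℝ → Torus → ℂ) (K : Finset ℤ) (R : ℕ) (k : ℤ) : ℝ → ℂ :=
  if k ∈ K then (Set.Icc (-(R:ℝ)) R).indicator (gg u k) else 0

lemma aa_nice (u : ℝ → Torus → ℂ) (K : Finset ℤ) (R : ℕ) (k : ℤ) : Nice (aa u K R k) := by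
  unfold aa
  split_ifs
  · exact nice_ind _ (gg_continuous u k) R
  · refine ⟨measurable_const, integrable_zero _ _ _, MemLp.zero⟩

lemma aa_bound (u : ℝ → Torus → ℂ) (K : Finset ℤ) (R : ℕ) :
    ∃ M : ℕ, ∀ k σ, aa u K R k σ ≠ 0 → jb (σ + (k:ℝ)^2) < 256 ^ M := by
  obtain ⟨M, hM⟩ := pow_unbounded_of_one_lt (1 + R + ∑ k ∈ K, (k:ℝ)^2) (by norm_num : (1:ℝ) < 256)
  refine ⟨M, fun k σ h => lt_of_le_of_lt ?_ hM⟩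
  unfold aa at h
  split_ifs at h with hk
  · have hs := Set.mem_of_indicator_ne_zero h
    have h1 : (k:ℝ)^2 ≤ ∑ k ∈ K, (k:ℝ)^2 :=
      Finset.single_le_sum (f := fun k : ℤ => (k:ℝ)^2) (fun _ _ => sq_nonneg _) hk
    unfold jb
    have h2 : |σ + (k:ℝ)^2| ≤ R + ∑ k ∈ K, (k:ℝ)^2 := by
      rw [abs_le]; constructor <;> nlinarith [hs.1, hs.2, sq_nonneg (k:ℝ)]
    have h3 := sq_le_sq' (by linarith [(abs_le.1 h2).1]) (abs_le.1 h2).2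
    have h4 := (abs_nonneg _).trans h2
    rw [Real.sqrt_le_left (by linarith)]
    nlinarith
  · exact absurd rfl h

lemma dual_id (u : ℝ → Torus → ℂ) (K : Finset ℤ) (R : ℕ) (k : ℤ) (hk : k ∈ K)
    (hc : Integrable (cf u k)) :
    ((∫ σ, ‖aa u K R k σ‖ ^ 2 : ℝ) : ℂ)
      = ∫ t, cf u k t * (starRingEnd ℂ) (EE (wt (aa u K R) k) t) := by
  rw [← dual_EE _ _ (wt_nice (aa_nice u K R) k).int hc, ← integral_complex_ofReal]
  congr 1; ext σ
  rw [← stFT_eq]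
  unfold wt
  by_cases hs : σ ∈ Set.Icc (-(R:ℝ)) R
  · have e : aa u K R k σ = gg u k σ := by
      unfold aa; rw [if_pos hk, Set.indicator_of_mem hs]
    rw [e, map_mul, Complex.conj_ofReal]
    have : (starRingEnd ℂ) (gg u k σ) * gg u k σ = ((‖gg u k σ‖ ^ 2 : ℝ) : ℂ) := by
      rw [mul_comm, Complex.mul_conj, Complex.normSq_eq_norm_sq]
    rw [← this]
    nth_rewrite 2 [gg]
    ring
  · have e : aa u K R k σ = 0 := by
      unfold aa; rw [if_pos hk, Set.indicator_of_notMem hs]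
    simp [e]

lemma mass_le (u : ℝ → Torus → ℂ) (K : Finset ℤ) (R : ℕ) (hK : ∀ k ∈ K, Integrable (cf u k)) :
    AEMeasurable (fun t => ‖∑ k ∈ K, cf u k t * (starRingEnd ℂ) (EE (wt (aa u K R) k) t)‖ₑ) ∧
    mass K (aa u K R)
      ≤ ∫⁻ t, ‖∑ k ∈ K, cf u k t * (starRingEnd ℂ) (EE (wt (aa u K R) k) t)‖ₑ := by
  have hw := fun k => (wt_nice (aa_nice u K R) k).int
  have hI : ∀ k ∈ K, Integrable (fun t => cf u k t * (starRingEnd ℂ) (EE (wt (aa u K R) k) t)) := by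
    intro k hk
    refine (hK k hk).mul_bdd (c := ∫ s, ‖wt (aa u K R) k s‖)
      (Complex.continuous_conj.comp (EE_continuous _ (hw k))).aestronglyMeasurable
      (Eventually.of_forall fun t => ?_)
    simpa using EE_norm_le _ t
  have hS := integrable_finsetSum K hI
  refine ⟨hS.aestronglyMeasurable.enorm, ?_⟩
  have e1 : mass K (aa u K R) = ENNReal.ofReal (∑ k ∈ K, ∫ σ, ‖aa u K R k σ‖ ^ 2) := by
    unfold mass
    rw [ENNReal.ofReal_sum_of_nonneg (fun k _ => integral_nonneg fun σ => by positivity)]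
    refine Finset.sum_congr rfl fun k _ => ?_
    rw [ofReal_integral_eq_lintegral_ofReal]
    · congr 1; ext σ
      rw [← ofReal_norm, ENNReal.ofReal_pow (norm_nonneg _)]
    · exact ((aa_nice u K R k).l2).integrable_norm_pow (by norm_num)
    · exact Eventually.of_forall fun σ => by positivity
  have e2 : ((∑ k ∈ K, ∫ σ, ‖aa u K R k σ‖ ^ 2 : ℝ) : ℂ)
      = ∫ t, ∑ k ∈ K, cf u k t * (starRingEnd ℂ) (EE (wt (aa u K R) k) t) := by
    rw [integral_finsetSum _ hI, Complex.ofReal_sum]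
    exact Finset.sum_congr rfl fun k hk => dual_id u K R k hk (hK k hk)
  rw [e1]
  refine le_trans ?_ (enorm_integral_le_lintegral_enorm _)
  rw [← e2, ← ofReal_norm, Complex.norm_real]
  exact ENNReal.ofReal_le_ofReal (le_abs_self _)

lemma lint_fin (f : Torus → ℂ) (hf : Continuous f) : ∫⁻ x : Torus, ‖f x‖ₑ ^ (4 : ℝ) ≠ ∞ := by
  obtain ⟨C, hC⟩ := (isCompact_univ (X := Torus)).exists_bound_of_continuousOn hf.continuousOn
  have h1 : ∀ x, ‖f x‖ₑ ^ (4 : ℝ) ≤ ENNReal.ofReal C ^ (4 : ℝ) := by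
    intro x
    refine ENNReal.rpow_le_rpow ?_ (by norm_num)
    rw [← ofReal_norm]
    exact ENNReal.ofReal_le_ofReal (hC x (Set.mem_univ _))
  have h2 : ∫⁻ x : Torus, ‖f x‖ₑ ^ (4 : ℝ) ≤ ∫⁻ _ : Torus, ENNReal.ofReal C ^ (4 : ℝ) :=
    lintegral_mono h1
  rw [lintegral_const] at h2
  exact ne_top_of_le_ne_top (ENNReal.mul_ne_top
    (ENNReal.rpow_ne_top_of_nonneg (by norm_num) ENNReal.ofReal_ne_top) (measure_ne_top _ _)) h2

lemma VV_sec (K : Finset ℤ) (b : ℤ → ℝ → ℂ) (t : ℝ) : Continuous (fun x : Torus => VV K b t x) := by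
  unfold VV
  exact continuous_finsetSum _ fun k _ => continuous_const.mul (fourier k).continuous

lemma main_est (u : ℝ → Torus → ℂ) (K : Finset ℤ) (R : ℕ) (hK : ∀ k ∈ K, Integrable (cf u k)) :
    mass K (aa u K R) ≤ (ENNReal.ofReal (64 * c0) ^ (1/4 : ℝ) * LpST (4/3) u) ^ 2 := by
  have hN := aa_nice u K R
  have hWN := fun k => wt_nice hN k
  obtain ⟨hm, hle⟩ := mass_le u K R hK
  obtain ⟨M, hM⟩ := aa_bound u K R
  have hL4 := L4_est K (aa u K R) hN M hM
  have hV := VV_continuous K (wt (aa u K R)) hWN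
  have hfin : mass K (aa u K R) ≠ ∞ := by
    unfold mass
    rw [ENNReal.sum_ne_top]
    exact fun k _ => (hN k).fin.ne
  apply cancel_sq _ _ hfin
  have hH := holder_lower
    (fun t => ‖∑ k ∈ K, cf u k t * (starRingEnd ℂ) (EE (wt (aa u K R) k) t)‖ₑ)
    (fun t => (∫⁻ x : Torus, ‖VV K (wt (aa u K R)) t x‖ₑ ^ (4 : ℝ)) ^ (1/4 : ℝ))
    (fun t => (∫⁻ x : Torus, ‖u t x‖ₑ ^ (4/3 : ℝ)) ^ (3/4 : ℝ)) hm ?_ ?_ ?_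
  · refine (hle.trans hH).trans ?_
    have e1 : (∫⁻ t, ((∫⁻ x : Torus, ‖u t x‖ₑ ^ (4/3 : ℝ)) ^ (3/4 : ℝ)) ^ (4/3 : ℝ)) ^ (3/4 : ℝ)
        = LpST (4/3) u := by
      unfold LpST
      simp_rw [← ENNReal.rpow_mul]
      norm_num
      rfl
    have e2 : ∫⁻ t, ((∫⁻ x : Torus, ‖VV K (wt (aa u K R)) t x‖ₑ ^ (4 : ℝ)) ^ (1/4 : ℝ)) ^ (4 : ℝ)
        = ∫⁻ t, ∫⁻ x : Torus, ‖VV K (wt (aa u K R)) t x‖ₑ ^ 4 := by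
      simp_rw [← ENNReal.rpow_mul]
      norm_num
    rw [e1, e2]
    calc _ ≤ LpST (4/3) u * (ENNReal.ofReal (64 * c0) * mass K (aa u K R) ^ 2) ^ (1/4 : ℝ) := by
          gcongr
      _ = _ := by
          rw [ENNReal.mul_rpow_of_nonneg _ _ (by norm_num), ← ENNReal.rpow_natCast,
            ← ENNReal.rpow_mul]
          norm_num
          ring
  · refine Measurable.aemeasurable ?_
    refine Measurable.pow_const ?_ _
    exact (hV.measurable.enorm.pow_const (4:ℝ)).lintegral_prod_right'
  · intro t
    refine ENNReal.rpow_ne_top_of_nonneg (by norm_num) ?_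
    have hc : Continuous (fun x : Torus => VV K (wt (aa u K R)) t x) :=
      VV_sec K _ t
    exact lint_fin _ hc
  · intro t
    exact pairing_le (u t) K (fun k => EE (wt (aa u K R) k) t)

lemma fin_est (u : ℝ → Torus → ℂ) (s : Finset ℤ) :
    ∑ k ∈ s, ∫⁻ σ, ‖gg u k σ‖ₑ ^ 2
      ≤ (ENNReal.ofReal (64 * c0) ^ (1/4 : ℝ) * LpST (4/3) u) ^ 2 := by
  classical
  set K := s.filter (fun k => Integrable (cf u k)) with hKd
  have e : ∑ k ∈ s, ∫⁻ σ, ‖gg u k σ‖ₑ ^ 2 = ∑ k ∈ K, ∫⁻ σ, ‖gg u k σ‖ₑ ^ 2 := by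
    rw [hKd, Finset.sum_filter]
    refine Finset.sum_congr rfl fun k _ => ?_
    split_ifs with h
    · rfl
    · simp [gg, stFT_zero u k h]
  rw [e]
  have hc : AECover (volume : Measure ℝ) atTop (fun R : ℕ => Set.Icc (-(R:ℝ)) R) :=
    aecover_Icc (tendsto_neg_atTop_atBot.comp tendsto_natCast_atTop_atTop)
      tendsto_natCast_atTop_atTop
  have ht : Tendsto (fun R : ℕ => ∑ k ∈ K, ∫⁻ σ in Set.Icc (-(R:ℝ)) R, ‖gg u k σ‖ₑ ^ 2) atTop
      (nhds (∑ k ∈ K, ∫⁻ σ, ‖gg u k σ‖ₑ ^ 2)) :=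
    tendsto_finsetSum _ fun k _ => hc.lintegral_tendsto_of_countably_generated
      ((gg_continuous u k).measurable.enorm.pow_const 2).aemeasurable
  refine le_of_tendsto' ht fun R => ?_
  refine le_trans (le_of_eq ?_) (main_est u K R fun k hk => (Finset.mem_filter.1 hk).2)
  unfold mass
  refine Finset.sum_congr rfl fun k hk => ?_
  rw [← lintegral_indicator measurableSet_Icc]
  congr 1; ext σ
  unfold aa
  rw [if_pos hk]
  by_cases hs : σ ∈ Set.Icc (-(R:ℝ)) R
  · simp only [Set.indicator_of_mem hs]
  · simp only [Set.indicator_of_notMem hs]; simp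

lemma XnormSq_eq (u : ℝ → Torus → ℂ) :
    XnormSq 0 (-(3/8)) u = ∑' k : ℤ, ∫⁻ σ, ‖gg u k σ‖ₑ ^ 2 := by
  unfold XnormSq
  rw [← lintegral_tsum fun k => ((gg_continuous u k).measurable.enorm.pow_const 2).aemeasurable]
  congr 1; ext σ; congr 1; ext k
  rw [← ofReal_norm, ← ENNReal.ofReal_pow (norm_nonneg _)]
  congr 1
  have hp : 0 < jb (σ + (k:ℝ)^2) := lt_of_lt_of_le one_pos (jb_one_le _)
  unfold gg
  rw [norm_mul, mul_pow, Complex.norm_real, Real.norm_of_nonneg (Real.rpow_nonneg hp.le _),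
    mul_zero, Real.rpow_zero, one_mul, ← Real.rpow_natCast (jb _ ^ _), ← Real.rpow_mul hp.le]
  norm_num

/-- Dual L⁴ Bourgain estimate: `‖u‖_{X^{0,-3/8}} ≤ C ‖u‖_{L^{4/3}(ℝ×𝕋)}`. -/
theorem dual_l4_bourgain :
    ∃ C : ℝ, 0 < C ∧ ∀ u : ℝ → Torus → ℂ, LpST (4/3) u ≠ ⊤ →
      Xnorm 0 (-(3/8)) u ≤ ENNReal.ofReal C * LpST (4/3) u := by
  have hc0 : 0 < 64 * c0 := by unfold c0; positivity
  refine ⟨(64 * c0) ^ (1/4 : ℝ), by positivity, fun u _ => ?_⟩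
  rw [← ENNReal.ofReal_rpow_of_pos hc0]
  unfold Xnorm
  rw [XnormSq_eq, ENNReal.tsum_eq_iSup_sum]
  calc _ ≤ ((ENNReal.ofReal (64 * c0) ^ (1/4 : ℝ) * LpST (4/3) u) ^ 2) ^ (1/2 : ℝ) :=
        ENNReal.rpow_le_rpow (iSup_le fun s => fin_est u s) (by norm_num)
    _ = _ := by
        rw [← ENNReal.rpow_natCast, ← ENNReal.rpow_mul]; norm_num

end
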